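/- Fix ν > 0, let f_1(x,t) = exp(i x − ν t) and f_2(x,t) = (i/(2ν)) exp(−4νt + 2ix)(1 − exp(2νt)). Then for every t > 0 and x ∈ ℝ, −∫_0^t ∫_ℝ G(x − y, ν(t − s)) · (f_1(y,s) ∂_y f_2(y,s) + f_2(y,s) ∂_y f_1(y,s)) dy ds = −(1/(8ν²)) · exp(−9νt + 3ix) · (1 − 3 exp(4νt) + 2 exp(6νt)). That is, the third sequence element of the initial value problem is f_3(x,t) = −exp(−9νt + 3ix)(1 − 3e^{4νt} + 2e^{6νt})/(8ν²). -/

import Mathlib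

open scoped BigOperators

/-- The one-dimensional heat kernel `G(y, τ) = (4πτ)^(−1/2) exp(−y²/(4τ))`. -/
noncomputable def heatKernel (y τ : ℝ) : ℝ :=
  (Real.sqrt (4 * Real.pi * τ))⁻¹ * Real.exp (-(y ^ 2) / (4 * τ))

/-- The heat kernel acts on the plane wave `exp(iky)` by the factor `exp(-k²τ)`. -/
theorem integral_heatKernel_mul_cexp (k x τ : ℝ) (hτ : 0 < τ) :
    ∫ y : ℝ, (heatKernel (x - y) τ : ℂ) * Complex.exp (Complex.I * k * y) =
      Complex.exp (Complex.I * k * x - k ^ 2 * τ) := by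
  have hτ' : (τ : ℂ) ≠ 0 := by exact_mod_cast hτ.ne'
  have hsub := MeasureTheory.integral_sub_left_eq_self
    (fun z : ℝ => (heatKernel z τ : ℂ) * Complex.exp (Complex.I * k * (x - z)))
    MeasureTheory.volume x
  have hfourier := fourierIntegral_gaussian (b := ((1 / (4 * τ) : ℝ) : ℂ))
    (by rw [Complex.ofReal_re]; positivity) (-k)
  have hsqrt : ((Real.pi : ℂ) / ((1 / (4 * τ) : ℝ) : ℂ)) ^ (1 / 2 : ℂ) =
      (Real.sqrt (4 * Real.pi * τ) : ℂ) := by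
    rw [Real.sqrt_eq_rpow, Complex.ofReal_cpow (by positivity)]
    congr 1
    · push_cast
      field_simp
    · norm_num
  have hpos : (Real.sqrt (4 * Real.pi * τ) : ℂ) ≠ 0 := by
    exact_mod_cast (Real.sqrt_pos.2 (by positivity)).ne'
  calc
    _ = ∫ z : ℝ, (heatKernel z τ : ℂ) * Complex.exp (Complex.I * k * (x - z)) := by
      rw [← hsub]
      simp
    _ = ∫ z : ℝ, ((Real.sqrt (4 * Real.pi * τ) : ℂ)⁻¹ * Complex.exp (Complex.I * k * x)) *
          (Complex.exp (Complex.I * (-k) * z) *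
            Complex.exp (-((1 / (4 * τ) : ℝ) : ℂ) * z ^ 2)) := by
      congr 1 with z
      have hsplit : Complex.exp (Complex.I * k * (x - z)) =
          Complex.exp (Complex.I * k * x) * Complex.exp (Complex.I * (-k) * z) := by
        rw [← Complex.exp_add]
        ring_nf
      have hgauss : (-(z : ℂ) ^ 2) / (4 * τ) = -((1 / (4 * τ) : ℝ) : ℂ) * z ^ 2 := by
        push_cast
        ring
      rw [hsplit, heatKernel]
      push_cast
      push_cast at hgauss
      rw [hgauss]
      ring
    _ = _ := by
      rw [MeasureTheory.integral_const_mul, hfourier, hsqrt, sub_eq_add_neg, Complex.exp_add]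
      have hexp : -(-(k : ℂ)) ^ 2 / (4 * ((1 / (4 * τ) : ℝ) : ℂ)) = -(k ^ 2 * τ) := by
        push_cast
        field_simp
      rw [hexp]
      field_simp

/-- The integral over `[0, t]` of an exponential with nonzero real rate. -/
theorem integral_cexp_ofReal_mul (a t : ℝ) (ha : a ≠ 0) :
    ∫ s in (0 : ℝ)..t, Complex.exp (a * s) = (Complex.exp (a * t) - 1) / a := by
  rw [integral_exp_mul_complex (by exact_mod_cast ha)]
  simp

/-- with `f₁(x,t) = exp(ix − νt)` and
`f₂(x,t) = (i/(2ν)) exp(−4νt + 2ix)(1 − exp(2νt))`, the third sequence element of the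
initial value problem is
`f₃(x,t) = −∫_0^t ∫_ℝ G(x−y, ν(t−s)) (f₁ ∂_y f₂ + f₂ ∂_y f₁)(y,s) dy ds
         = −(1/(8ν²)) exp(−9νt + 3ix)(1 − 3 exp(4νt) + 2 exp(6νt))`. -/
theorem third_sequence_element
    (ν : ℝ) (hν : 0 < ν)
    (f₁ f₂ : ℝ → ℝ → ℂ)
    (hf₁ : ∀ x t : ℝ, f₁ x t = Complex.exp (Complex.I * x - ν * t))
    (hf₂ : ∀ x t : ℝ, f₂ x t =
      Complex.I / (2 * ν) * Complex.exp (-(4 * ν * t) + 2 * Complex.I * x) *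
        (1 - Complex.exp (2 * ν * t))) :
    ∀ t : ℝ, 0 < t → ∀ x : ℝ,
      -(∫ s in (0 : ℝ)..t, ∫ y : ℝ,
          (heatKernel (x - y) (ν * (t - s)) : ℂ) *
            (f₁ y s * deriv (fun y' : ℝ => f₂ y' s) y +
              f₂ y s * deriv (fun y' : ℝ => f₁ y' s) y))
        = -(1 / (8 * (ν : ℂ) ^ 2)) * Complex.exp (-(9 * ν * t) + 3 * Complex.I * x) *
            (1 - 3 * Complex.exp (4 * ν * t) + 2 * Complex.exp (6 * ν * t)) := by
  intro t ht x
  have hν' : (ν : ℂ) ≠ 0 := by exact_mod_cast hν.ne'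
  have hderiv₁ (y s : ℝ) : deriv (fun y' : ℝ => f₁ y' s) y = Complex.I * f₁ y s := by
    have hid : HasDerivAt (fun y' : ℝ => (y' : ℂ)) 1 y := Complex.ofRealCLM.hasDerivAt
    have h := ((hid.const_mul Complex.I).sub_const (ν * s : ℂ)).cexp
    simp only [hf₁]
    rw [h.deriv]
    ring
  have hderiv₂ (y s : ℝ) : deriv (fun y' : ℝ => f₂ y' s) y = 2 * Complex.I * f₂ y s := by
    have hid : HasDerivAt (fun y' : ℝ => (y' : ℂ)) 1 y := Complex.ofRealCLM.hasDerivAt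
    have h := ((((hid.const_mul (2 * Complex.I)).const_add (-(4 * ν * s) : ℂ)).cexp.const_mul
      (Complex.I / (2 * ν))).mul_const (1 - Complex.exp (2 * ν * s)))
    simp only [hf₂]
    rw [h.deriv]
    ring
  have hsource (y s : ℝ) :
      f₁ y s * deriv (fun y' : ℝ => f₂ y' s) y + f₂ y s * deriv (fun y' : ℝ => f₁ y' s) y =
        (-(3 / (2 * ν)) * (Complex.exp (-(5 * ν * s)) * (1 - Complex.exp (2 * ν * s)))) *
          Complex.exp (Complex.I * (3 : ℝ) * y) := by
    have hexp : Complex.exp (Complex.I * y - ν * s) *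
        Complex.exp (-(4 * ν * s) + 2 * Complex.I * y) =
          Complex.exp (-(5 * ν * s)) * Complex.exp (Complex.I * (3 : ℝ) * y) := by
      rw [← Complex.exp_add, ← Complex.exp_add]
      push_cast
      ring_nf
    rw [hderiv₁, hderiv₂, hf₁, hf₂]
    linear_combination (3 * Complex.I ^ 2 / (2 * ν) * (1 - Complex.exp (2 * ν * s))) * hexp +
      (3 / (2 * ν) * (1 - Complex.exp (2 * ν * s)) * Complex.exp (-(5 * ν * s)) *
        Complex.exp (Complex.I * (3 : ℝ) * y)) * Complex.I_sq
  have hinner (s : ℝ) (hs : s < t) :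
      ∫ y : ℝ, (heatKernel (x - y) (ν * (t - s)) : ℂ) *
          (f₁ y s * deriv (fun y' : ℝ => f₂ y' s) y +
            f₂ y s * deriv (fun y' : ℝ => f₁ y' s) y) =
        (-(3 / (2 * ν)) * Complex.exp (-(9 * ν * t) + 3 * Complex.I * x)) *
          (Complex.exp ((4 * ν : ℝ) * s) - Complex.exp ((6 * ν : ℝ) * s)) := by
    simp_rw [hsource, mul_left_comm _ (-(3 / (2 * (ν : ℂ))) * _)]
    rw [MeasureTheory.integral_const_mul,
      integral_heatKernel_mul_cexp 3 x _ (mul_pos hν (sub_pos.2 hs))]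
    simp only [mul_assoc, mul_sub, sub_mul, mul_one, ← Complex.exp_add]
    push_cast
    ring_nf
  have houter : ∫ s in (0 : ℝ)..t, ∫ y : ℝ,
        (heatKernel (x - y) (ν * (t - s)) : ℂ) *
          (f₁ y s * deriv (fun y' : ℝ => f₂ y' s) y +
            f₂ y s * deriv (fun y' : ℝ => f₁ y' s) y) =
      ∫ s in (0 : ℝ)..t, (-(3 / (2 * ν)) * Complex.exp (-(9 * ν * t) + 3 * Complex.I * x)) *
          (Complex.exp ((4 * ν : ℝ) * s) - Complex.exp ((6 * ν : ℝ) * s)) := by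
    refine intervalIntegral.integral_congr_ae ?_
    filter_upwards [MeasureTheory.Measure.ae_ne MeasureTheory.volume t] with s hne hs
    rw [Set.uIoc_of_le ht.le] at hs
    exact hinner s (lt_of_le_of_ne hs.2 hne)
  rw [houter, intervalIntegral.integral_const_mul, intervalIntegral.integral_sub
    (Continuous.intervalIntegrable (by fun_prop) _ _)
    (Continuous.intervalIntegrable (by fun_prop) _ _),
    integral_cexp_ofReal_mul _ _ (by positivity), integral_cexp_ofReal_mul _ _ (by positivity)]
  push_cast
  field_simp
  ring
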